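/- arXiv:2605.04168 — 2 statements merged into one kernel-verified Lean document; each statement's English description precedes it below -/
import Mathlib

section
/- Let d ≥ 1, s, s₂ ∈ (0,1), q > d/(1-s), q₂ > 1/(1-s₂), T > 0, δ ∈ (0,1], and let K ⊂ ℝ^d be compact with positive Lebesgue measure. There exists a constant C = C(d, s, s₂, q, q₂, T, K, δ) such that for every twice continuously differentiable σ : ℝ × ℝ^d → ℝ vanishing outside [0,T] × K and every δ-Hölder continuous path x : [0,T] → K with Hölder seminorm [x]_δ, and all r, y ∈ [0,T]: |σ(r, x(r)) - σ(y, x(y))| ≤ C (1 + [x]_δ^s) ( ‖∂_t ∇_z σ‖_{(q₂,q)} + ‖∇_z σ‖_{(q₂,q)} + ‖∂_t σ‖_{(q₂,q)} ) |r - y|^{min(sδ, s₂)}. -/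
open MeasureTheory
open scoped ENNReal

/-- The mixed Lebesgue norm `‖g‖_{(ρ,q)} = (∫_0^T (∫_K |g(t,x)|^q dx)^{ρ/q} dt)^{1/ρ}`. -/
noncomputable def mnorm (d : ℕ) (T ρ q : ℝ) (K : Set (EuclideanSpace ℝ (Fin d)))
    (g : ℝ → EuclideanSpace ℝ (Fin d) → ℝ) : ℝ :=
  (∫ t in Set.Icc (0:ℝ) T, (∫ x in K, |g t x| ^ q) ^ (ρ / q)) ^ (1 / ρ)

section Morrey

theorem enorm_sub_le_lintegral_fderiv {E : Type*} [NormedAddCommGroup E] [NormedSpace ℝ E]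
    {u : E → ℝ} (hu : ContDiff ℝ 1 u) (a z : E) :
    ‖u z - u a‖ₑ ≤
      ∫⁻ θ in Set.Ioc (0:ℝ) 1, ‖fderiv ℝ u (a + θ • (z - a))‖ₑ * ‖z - a‖ₑ := by
  have hc := hu.continuous_fderiv one_ne_zero
  have h : ∫ θ in (0:ℝ)..1, fderiv ℝ u (a + θ • (z - a)) (z - a) = u z - u a := by
    rw [intervalIntegral.integral_eq_sub_of_hasDerivAt
      (f := fun θ : ℝ => u (a + θ • (z - a)))]
    · simp
    · intro θ _
      have h1 : HasDerivAt (fun θ : ℝ => a + θ • (z - a)) (z - a) θ := by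
        simpa using ((hasDerivAt_id θ).smul_const (z - a)).const_add a
      exact ((hu.differentiable one_ne_zero).differentiableAt.hasFDerivAt.comp_hasDerivAt θ h1)
    · exact Continuous.intervalIntegrable (by fun_prop) _ _
  rw [← h, intervalIntegral.integral_of_le zero_le_one]
  refine (enorm_integral_le_lintegral_enorm _).trans (lintegral_mono fun θ => ?_)
  exact ContinuousLinearMap.le_opENorm _ _

variable {E : Type*} [NormedAddCommGroup E] [NormedSpace ℝ E] [FiniteDimensional ℝ E]
  [MeasurableSpace E] [BorelSpace E] (μ : Measure E) [μ.IsAddHaarMeasure]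

/-- The effect of a homothety of ratio `θ` on the Lebesgue integral. -/
theorem lintegral_comp_homothety {f : E → ℝ≥0∞} (hf : Measurable f) (a : E) {θ : ℝ}
    (hθ : 0 < θ) :
    ∫⁻ z, f (a + θ • (z - a)) ∂μ =
      ENNReal.ofReal (θ ^ (-(Module.finrank ℝ E : ℝ))) * ∫⁻ z, f z ∂μ := by
  rw [lintegral_sub_right_eq_self (fun z => f (a + θ • z)) a]
  have h1 : ∫⁻ z, f (a + θ • z) ∂μ = ∫⁻ w, f (a + w) ∂(Measure.map (θ • ·) μ) := by
    rw [lintegral_map (by fun_prop) (by fun_prop)]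
  rw [h1, Measure.map_addHaar_smul μ hθ.ne', lintegral_smul_measure,
    lintegral_add_left_eq_self f a, smul_eq_mul, abs_of_pos (by positivity),
    Real.rpow_neg hθ.le, Real.rpow_natCast]

/-- Hölder's inequality on a homothetic copy of a set. -/
theorem setLIntegral_comp_homothety_le {f : E → ℝ≥0∞} (hf : Measurable f) (a : E) {θ q : ℝ}
    (hθ : 0 < θ) (hq : 1 < q) (S : Set E) :
    ∫⁻ z in S, f (a + θ • (z - a)) ∂μ ≤
      ENNReal.ofReal (θ ^ (-(Module.finrank ℝ E / q : ℝ))) * μ S ^ (1 - 1 / q) *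
        (∫⁻ z, f z ^ q ∂μ) ^ (1 / q) := by
  have hq0 : 0 < q := by linarith
  have hpq : q.HolderConjugate (q / (q - 1)) := .conjExponent hq
  have h := ENNReal.lintegral_mul_le_Lp_mul_Lq (μ.restrict S) hpq
    (f := fun z => f (a + θ • (z - a))) (g := fun _ => 1) (by fun_prop) (by fun_prop)
  have e : 1 / (q / (q - 1)) = 1 - 1 / q := by
    have : q - 1 ≠ 0 := by linarith
    field_simp
  simp only [Pi.mul_apply, mul_one, ENNReal.one_rpow, lintegral_const, one_mul, e,
    Measure.restrict_apply_univ] at h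
  refine h.trans ?_
  have h2 : (∫⁻ z in S, f (a + θ • (z - a)) ^ q ∂μ) ^ (1 / q) ≤
      ENNReal.ofReal (θ ^ (-(Module.finrank ℝ E / q : ℝ))) * (∫⁻ z, f z ^ q ∂μ) ^ (1 / q) := by
    calc _ ≤ (∫⁻ z, f (a + θ • (z - a)) ^ q ∂μ) ^ (1 / q) := by
          gcongr
          exact Measure.restrict_le_self
      _ = _ := by
          rw [lintegral_comp_homothety μ (f := fun z => f z ^ q) (by fun_prop) a hθ,
            ENNReal.mul_rpow_of_nonneg _ _ (by positivity),
            ENNReal.ofReal_rpow_of_nonneg (by positivity) (by positivity),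
            ← Real.rpow_mul hθ.le]
          congr 4
          ring
  calc _ ≤ _ := mul_le_mul_left h2 _
    _ = _ := by ring

theorem setLIntegral_enorm_sub_le {u : E → ℝ} (hu : ContDiff ℝ 1 u) {q : ℝ} (hq : 1 < q)
    (a : E) {S : Set E} (hS : MeasurableSet S) {R : ℝ≥0∞} (hR : ∀ z ∈ S, ‖z - a‖ₑ ≤ R) :
    ∫⁻ z in S, ‖u z - u a‖ₑ ∂μ ≤
      R * (∫⁻ θ in Set.Ioc (0:ℝ) 1, ENNReal.ofReal (θ ^ (-(Module.finrank ℝ E / q : ℝ)))) *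
        μ S ^ (1 - 1 / q) * (∫⁻ z, ‖fderiv ℝ u z‖ₑ ^ q ∂μ) ^ (1 / q) := by
  have hc := hu.continuous_fderiv one_ne_zero
  calc ∫⁻ z in S, ‖u z - u a‖ₑ ∂μ
      ≤ ∫⁻ z in S, (∫⁻ θ in Set.Ioc (0:ℝ) 1, ‖fderiv ℝ u (a + θ • (z - a))‖ₑ * R) ∂μ := by
        refine setLIntegral_mono' hS fun z hz => ?_
        refine (enorm_sub_le_lintegral_fderiv hu a z).trans (lintegral_mono fun θ => ?_)
        exact mul_le_mul_right (hR z hz) _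
    _ = ∫⁻ θ in Set.Ioc (0:ℝ) 1, (∫⁻ z in S, ‖fderiv ℝ u (a + θ • (z - a))‖ₑ * R ∂μ) := by
        apply lintegral_lintegral_swap
        apply Measurable.aemeasurable
        have : Continuous fun p : E × ℝ => fderiv ℝ u (a + p.2 • (p.1 - a)) := by fun_prop
        exact this.measurable.enorm.mul_const _
    _ ≤ ∫⁻ θ in Set.Ioc (0:ℝ) 1, ENNReal.ofReal (θ ^ (-(Module.finrank ℝ E / q : ℝ))) *
          (μ S ^ (1 - 1 / q) * (∫⁻ z, ‖fderiv ℝ u z‖ₑ ^ q ∂μ) ^ (1 / q) * R) := by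
        refine setLIntegral_mono' measurableSet_Ioc fun θ hθ => ?_
        have hm : Measurable fun z => ‖fderiv ℝ u (a + θ • (z - a))‖ₑ :=
          Continuous.measurable (by fun_prop)
        rw [lintegral_mul_const _ hm, ← mul_assoc, ← mul_assoc]
        gcongr
        exact setLIntegral_comp_homothety_le μ (f := fun z => ‖fderiv ℝ u z‖ₑ)
          hc.measurable.enorm a hθ.1 hq S
    _ = _ := by
        rw [lintegral_mul_const _ (by fun_prop)]
        ring

/-- **Morrey's inequality**. -/
theorem exists_enorm_sub_le_morrey {q : ℝ} (hq : 1 < q) (hqd : (Module.finrank ℝ E : ℝ) < q) :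
    ∃ C : ℝ, 0 < C ∧ ∀ u : E → ℝ, ContDiff ℝ 1 u → ∀ a b : E,
      ‖u a - u b‖ₑ ≤ ENNReal.ofReal (C * ‖a - b‖ ^ (1 - Module.finrank ℝ E / q : ℝ)) *
        (∫⁻ z, ‖fderiv ℝ u z‖ₑ ^ q ∂μ) ^ (1 / q) := by
  have hq0 : 0 < q := by linarith
  set n := Module.finrank ℝ E with hn
  set I := ∫⁻ θ in Set.Ioc (0:ℝ) 1, ENNReal.ofReal (θ ^ (-(n / q : ℝ))) with hI
  have hItop : I ≠ ∞ := by
    have h := intervalIntegral.intervalIntegrable_rpow' (a := 0) (b := 1) (r := -(n / q : ℝ))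
      (by rw [neg_lt_neg_iff, div_lt_one hq0]; exact hqd)
    rw [intervalIntegrable_iff_integrableOn_Ioc_of_le zero_le_one] at h
    exact h.lintegral_lt_top.ne
  set ω := (μ (Metric.closedBall 0 1)).toReal with hω
  have hωtop : μ (Metric.closedBall (0:E) 1) ≠ ∞ := measure_closedBall_lt_top.ne
  have hωpos : 0 < ω :=
    ENNReal.toReal_pos (Metric.measure_closedBall_pos μ 0 one_pos).ne' hωtop
  refine ⟨3 * (I.toReal + 1) * ω ^ (-(1 / q)), by positivity, fun u hu a b => ?_⟩
  rcases eq_or_ne a b with rfl | hab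
  · simp
  set R := ‖a - b‖ with hR
  have hRpos : 0 < R := norm_pos_iff.2 (sub_ne_zero.2 hab)
  set S := Metric.closedBall a R
  have hS : MeasurableSet S := measurableSet_closedBall
  have hμS : μ S = ENNReal.ofReal (R ^ n * ω) := by
    rw [Measure.addHaar_closedBall' μ a hRpos.le, ENNReal.ofReal_mul (by positivity), hω,
      ENNReal.ofReal_toReal hωtop]
  set N := (∫⁻ z, ‖fderiv ℝ u z‖ₑ ^ q ∂μ) ^ (1 / q)
  have h1 := setLIntegral_enorm_sub_le μ hu hq a hS (R := ENNReal.ofReal R) fun z hz => by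
    rw [← ofReal_norm]
    exact ENNReal.ofReal_le_ofReal (by simpa [S, dist_eq_norm] using hz)
  have h2 := setLIntegral_enorm_sub_le μ hu hq b hS (R := ENNReal.ofReal (2 * R)) fun z hz => by
    rw [← ofReal_norm]
    refine ENNReal.ofReal_le_ofReal ?_
    have h3 : ‖z - a‖ ≤ R := by simpa [S, dist_eq_norm] using hz
    calc ‖z - b‖ ≤ ‖z - a‖ + ‖a - b‖ := norm_sub_le_norm_sub_add_norm_sub z a b
      _ ≤ 2 * R := by linarith
  have h3 : μ S * ‖u a - u b‖ₑ ≤ ENNReal.ofReal (3 * R) * I * μ S ^ (1 - 1 / q) * N := by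
    calc μ S * ‖u a - u b‖ₑ = ∫⁻ z in S, ‖u a - u b‖ₑ ∂μ := by simp [mul_comm]
      _ ≤ ∫⁻ z in S, (‖u z - u a‖ₑ + ‖u z - u b‖ₑ) ∂μ := by
          refine lintegral_mono fun z => ?_
          have : u a - u b = (u z - u b) - (u z - u a) := by ring
          rw [this, add_comm]
          exact enorm_sub_le
      _ = ∫⁻ z in S, ‖u z - u a‖ₑ ∂μ + ∫⁻ z in S, ‖u z - u b‖ₑ ∂μ := by
          have := hu.continuous
          exact lintegral_add_left (Continuous.measurable (by fun_prop)) _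
      _ ≤ _ := add_le_add h1 h2
      _ = _ := by
          rw [show (3:ℝ) * R = R + 2 * R by ring, ENNReal.ofReal_add hRpos.le (by positivity)]
          ring
  have hμpos : μ S ≠ 0 := (Metric.measure_closedBall_pos μ a hRpos).ne'
  have hμtop : μ S ≠ ∞ := measure_closedBall_lt_top.ne
  have h4 : ‖u a - u b‖ₑ ≤ ENNReal.ofReal (3 * R) * I * μ S ^ (-(1 / q)) * N := by
    rw [← ENNReal.mul_le_mul_iff_right hμpos hμtop]
    refine h3.trans_eq ?_
    rw [sub_eq_add_neg, ENNReal.rpow_add _ _ hμpos hμtop, ENNReal.rpow_one]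
    ring
  refine h4.trans ?_
  gcongr
  have e : 3 * (I.toReal + 1) * ω ^ (-(1 / q)) * R ^ (1 - n / q : ℝ) =
      3 * R * (I.toReal + 1) * (R ^ n * ω) ^ (-(1 / q)) := by
    rw [Real.mul_rpow (by positivity) hωpos.le, ← Real.rpow_natCast, ← Real.rpow_mul hRpos.le,
      sub_eq_add_neg, Real.rpow_add hRpos, Real.rpow_one]
    ring_nf
  rw [e, hμS, ENNReal.ofReal_rpow_of_pos (by positivity),
    ENNReal.ofReal_mul (p := 3 * R * (I.toReal + 1)) (by positivity),
    ENNReal.ofReal_mul (p := 3 * R) (by positivity)]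
  gcongr
  rw [ENNReal.le_ofReal_iff_toReal_le hItop (by positivity)]
  linarith

/-- Morrey's inequality for functions vanishing outside a compact set. -/
theorem exists_abs_sub_le_morrey {q : ℝ} (hq : 1 < q) (hqd : (Module.finrank ℝ E : ℝ) < q)
    {K : Set E} (hK : IsCompact K) :
    ∃ C : ℝ, 0 < C ∧ ∀ u : E → ℝ, ContDiff ℝ 1 u → (∀ z ∉ K, u z = 0) → ∀ a b : E,
      |u a - u b| ≤ C * ‖a - b‖ ^ (1 - Module.finrank ℝ E / q : ℝ) *
        (∫ z in K, ‖fderiv ℝ u z‖ ^ q ∂μ) ^ (1 / q) := by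
  have hq0 : 0 < q := by linarith
  obtain ⟨C, hC, h⟩ := exists_enorm_sub_le_morrey μ hq hqd
  refine ⟨C, hC, fun u hu hu0 a b => ?_⟩
  have hc : Continuous fun z => ‖fderiv ℝ u z‖ ^ q :=
    (hu.continuous_fderiv one_ne_zero).norm.rpow_const fun _ => Or.inr hq0.le
  have hzero : ∀ z ∉ K, ‖fderiv ℝ u z‖ ^ q = 0 := by
    intro z hz
    have : u =ᶠ[nhds z] fun _ => 0 := by
      filter_upwards [hK.isClosed.isOpen_compl.mem_nhds hz] with w hw using hu0 w hw
    rw [this.fderiv_eq]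
    simp [hq0.ne']
  have hint : Integrable (fun z => ‖fderiv ℝ u z‖ ^ q) μ := by
    rw [← integrableOn_iff_integrable_of_support_subset (s := K)
      (Function.support_subset_iff'.2 hzero)]
    exact hc.continuousOn.integrableOn_compact hK
  have hlint : ∫⁻ z, ‖fderiv ℝ u z‖ₑ ^ q ∂μ =
      ENNReal.ofReal (∫ z in K, ‖fderiv ℝ u z‖ ^ q ∂μ) := by
    rw [setIntegral_eq_integral_of_forall_compl_eq_zero hzero,
      ofReal_integral_eq_lintegral_ofReal hint (Filter.Eventually.of_forall fun z => by positivity)]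
    refine lintegral_congr fun z => ?_
    rw [← ofReal_norm, ENNReal.ofReal_rpow_of_nonneg (norm_nonneg _) hq0.le]
  have hnn : 0 ≤ ∫ z in K, ‖fderiv ℝ u z‖ ^ q ∂μ := integral_nonneg fun z => by positivity
  have := h u hu a b
  rw [hlint, ENNReal.ofReal_rpow_of_nonneg hnn (by positivity),
    ← ENNReal.ofReal_mul (by positivity), ← ofReal_norm,
    ENNReal.ofReal_le_ofReal_iff (by positivity)] at this
  exact this

end Morrey

section Time

/-- Hölder's inequality on a subinterval of `[0, T]`. -/
theorem abs_intervalIntegral_le_rpow_mul {G : ℝ → ℝ} (hG : Continuous G) (hG0 : ∀ t, 0 ≤ G t)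
    {T p : ℝ} (hp : 1 < p) {r y : ℝ} (hr : r ∈ Set.Icc 0 T) (hy : y ∈ Set.Icc 0 T) :
    |∫ t in y..r, G t| ≤
      |r - y| ^ (1 - 1 / p) * (∫ t in Set.Icc 0 T, G t ^ p) ^ (1 / p) := by
  wlog hyr : y ≤ r generalizing r y
  · rw [intervalIntegral.integral_symm, abs_neg, abs_sub_comm]
    exact this hy hr (le_of_not_ge hyr)
  have hp0 : 0 < p := by linarith
  have hpq : (p / (p - 1)).HolderConjugate p := (Real.HolderConjugate.conjExponent hp).symm
  have hGm : ∀ e, MemLp G (ENNReal.ofReal e) (volume.restrict (Set.Ioc y r)) := fun e => by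
    have hfin : IsFiniteMeasure (volume.restrict (Set.Ioc y r)) := inferInstance
    obtain ⟨M, hM⟩ := isCompact_Icc.exists_bound_of_continuousOn (s := Set.Icc y r)
      hG.continuousOn
    refine MemLp.of_bound hG.aestronglyMeasurable M ?_
    filter_upwards [ae_restrict_mem measurableSet_Ioc] with t ht
      using hM t (Set.Ioc_subset_Icc_self ht)
  have h := integral_mul_le_Lp_mul_Lq_of_nonneg (μ := volume.restrict (Set.Ioc y r)) hpq
    (f := fun _ => (1:ℝ)) (g := G) (Filter.Eventually.of_forall fun _ => zero_le_one)
    (Filter.Eventually.of_forall hG0) (memLp_const 1) (hGm p)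
  have e : 1 / (p / (p - 1)) = 1 - 1 / p := by
    have : p - 1 ≠ 0 := by linarith
    field_simp
  simp only [one_mul, Real.one_rpow, e, integral_const, smul_eq_mul, mul_one,
    measureReal_restrict_apply_univ, Real.volume_real_Ioc_of_le hyr] at h
  rw [intervalIntegral.integral_of_le hyr, abs_of_nonneg (integral_nonneg hG0),
    abs_of_nonneg (sub_nonneg.2 hyr)]
  refine h.trans ?_
  have hnn : ∀ t, 0 ≤ G t ^ p := fun t => Real.rpow_nonneg (hG0 t) _
  have hsub : Set.Ioc y r ⊆ Set.Icc 0 T := fun t ht =>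
    ⟨hy.1.trans ht.1.le, ht.2.trans hr.2⟩
  gcongr ?_ * ?_ ^ _
  · exact integral_nonneg hnn
  · refine setIntegral_mono_set ?_ (Filter.Eventually.of_forall hnn) hsub.eventuallyLE
    exact (hG.rpow_const fun _ => Or.inr hp0.le).continuousOn.integrableOn_compact isCompact_Icc

/-- A function whose derivative is bounded by `k G` varies by at most `k ∫ G`. -/
theorem abs_sub_le_mul_abs_integral {v v' G : ℝ → ℝ} {k : ℝ} (hv : ∀ t, HasDerivAt v (v' t) t)
    (hv' : Continuous v') (hG : Continuous G) (hk : 0 ≤ k) (hle : ∀ t, |v' t| ≤ k * G t)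
    (y r : ℝ) : |v r - v y| ≤ k * |∫ t in y..r, G t| := by
  rw [← intervalIntegral.integral_eq_sub_of_hasDerivAt (fun t _ => hv t)
    (hv'.intervalIntegrable _ _)]
  have h := intervalIntegral.norm_integral_le_abs_of_norm_le (μ := volume) (a := y) (b := r)
    (f := v') (g := fun t => k * G t) (Filter.Eventually.of_forall fun t => hle t)
    (Continuous.intervalIntegrable (by fun_prop) _ _)
  rwa [intervalIntegral.integral_const_mul, abs_mul, abs_of_nonneg hk] at h

end Time

section PartialDerivatives

variable {E : Type*} [NormedAddCommGroup E] [NormedSpace ℝ E] {σ : ℝ → E → ℝ}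

theorem hasDerivAt_fst_of_differentiable (hσ : Differentiable ℝ (Function.uncurry σ)) (t : ℝ)
    (z : E) :
    HasDerivAt (fun τ => σ τ z) (fderiv ℝ (Function.uncurry σ) (t, z) (1, 0)) t :=
  (hσ (t, z)).hasFDerivAt.comp_hasDerivAt (f := fun τ => (τ, z)) t
    ((hasDerivAt_id t).prodMk (hasDerivAt_const t z))

theorem fderiv_snd_of_differentiable (hσ : Differentiable ℝ (Function.uncurry σ)) (t : ℝ)
    (z : E) :
    fderiv ℝ (σ t) z =
      (fderiv ℝ (Function.uncurry σ) (t, z)).comp (ContinuousLinearMap.inr ℝ ℝ E) :=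
  ((hσ (t, z)).hasFDerivAt.comp (f := fun w => (t, w)) z
    (hasFDerivAt_prodMk_right t z)).fderiv

/-- The time derivative of the spatial gradient is the spatial gradient of the time derivative. -/
theorem deriv_fderiv_eq_fderiv_deriv (hσ : ContDiff ℝ 2 (Function.uncurry σ)) (t : ℝ) (z : E) :
    deriv (fun τ => fderiv ℝ (σ τ) z) t =
      fderiv ℝ (fun w => fderiv ℝ (Function.uncurry σ) (t, w) (1, 0)) z := by
  have hd : Differentiable ℝ (Function.uncurry σ) := hσ.differentiable two_ne_zero
  have hd2 : HasFDerivAt (fderiv ℝ (Function.uncurry σ))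
      (fderiv ℝ (fderiv ℝ (Function.uncurry σ)) (t, z)) (t, z) :=
    (((hσ.fderiv_right (m := 1) (by norm_num)).differentiable one_ne_zero) (t, z)).hasFDerivAt
  have h1 : HasDerivAt (fun τ => fderiv ℝ (Function.uncurry σ) (τ, z))
      (fderiv ℝ (fderiv ℝ (Function.uncurry σ)) (t, z) (1, 0)) t :=
    hd2.comp_hasDerivAt (f := fun τ => (τ, z)) t
      ((hasDerivAt_id t).prodMk (hasDerivAt_const t z))
  have h2 : HasFDerivAt (fun w => fderiv ℝ (Function.uncurry σ) (t, w)) _ z :=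
    hd2.comp (f := fun w => (t, w)) z (hasFDerivAt_prodMk_right t z)
  have h3 := h2.clm_apply (hasFDerivAt_const ((1 : ℝ), (0 : E)) z)
  simp only [fderiv_snd_of_differentiable hd]
  rw [(h1.clm_comp (hasDerivAt_const t (ContinuousLinearMap.inr ℝ ℝ E))).deriv, h3.fderiv]
  ext v
  have := (hσ.contDiffAt (x := (t, z))).isSymmSndFDerivAt (by simp)
  simpa using this.eq (1, 0) (0, v)

end PartialDerivatives

theorem Real.rpow_le_rpow_sub_mul_rpow {x D s α : ℝ} (hx : 0 ≤ x) (hxD : x ≤ D) (hs : 0 < s)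
    (hsα : s ≤ α) : x ^ α ≤ D ^ (α - s) * x ^ s := by
  have hαs : 0 ≤ α - s := sub_nonneg.2 hsα
  calc x ^ α = x ^ (α - s) * x ^ s := by
        rw [← Real.rpow_add_of_nonneg hx hαs hs.le, sub_add_cancel]
    _ ≤ _ := by gcongr

/-- Hölder continuity in time of `t ↦ σ(t, x(t))` along a `δ`-Hölder path `x` with values in
`K`, with constant controlled by the mixed norms of the partial derivatives of `σ`:
`|σ(r,x(r)) - σ(y,x(y))| ≤ C (1 + [x]_δ^s)(‖∂_t∇_zσ‖ + ‖∇_zσ‖ + ‖∂_tσ‖) |r-y|^{min(sδ,s₂)}`. -/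
theorem stmt10 (d : ℕ) (hd : 1 ≤ d) (s s₂ q q₂ T δ : ℝ)
    (hs : s ∈ Set.Ioo (0:ℝ) 1) (hs₂ : s₂ ∈ Set.Ioo (0:ℝ) 1)
    (hq : q > (d : ℝ) / (1 - s)) (hq₂ : q₂ > 1 / (1 - s₂)) (hT : 0 < T)
    (hδ : δ ∈ Set.Ioc (0:ℝ) 1)
    (K : Set (EuclideanSpace ℝ (Fin d))) (hK : IsCompact K) (hK0 : 0 < volume K) :
    ∃ C > 0, ∀ (σ : ℝ → EuclideanSpace ℝ (Fin d) → ℝ)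
      (x : ℝ → EuclideanSpace ℝ (Fin d)) (L : ℝ),
      ContDiff ℝ 2 (Function.uncurry σ) →
      (∀ t z, (t, z) ∉ Set.Icc (0:ℝ) T ×ˢ K → σ t z = 0) →
      (∀ t ∈ Set.Icc (0:ℝ) T, x t ∈ K) →
      0 ≤ L →
      (∀ u ∈ Set.Icc (0:ℝ) T, ∀ v ∈ Set.Icc (0:ℝ) T, dist (x u) (x v) ≤ L * |u - v| ^ δ) →
      ∀ r ∈ Set.Icc (0:ℝ) T, ∀ y ∈ Set.Icc (0:ℝ) T,
        |σ r (x r) - σ y (x y)| ≤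
          C * (1 + L ^ s) *
            (mnorm d T q₂ q K (fun t z => ‖deriv (fun τ => fderiv ℝ (σ τ) z) t‖) +
             mnorm d T q₂ q K (fun t z => ‖fderiv ℝ (σ t) z‖) +
             mnorm d T q₂ q K (fun t z => |deriv (fun τ => σ τ z) t|)) *
          |r - y| ^ min (s * δ) s₂ := by
  obtain ⟨hs0, hs1⟩ := hs
  obtain ⟨hs₂0, hs₂1⟩ := hs₂
  have hd1 : (1:ℝ) ≤ d := by exact_mod_cast hd
  have hdq : (d:ℝ) < q * (1 - s) := by rwa [gt_iff_lt, div_lt_iff₀ (by linarith)] at hq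
  have hq1 : 1 < q := by
    refine lt_trans ?_ hq
    rw [lt_div_iff₀ (by linarith)]
    linarith
  have hq0 : 0 < q := by linarith
  have hq₂' : 1 < q₂ * (1 - s₂) := by rwa [gt_iff_lt, div_lt_iff₀ (by linarith)] at hq₂
  have hq₂1 : 1 < q₂ := by
    refine lt_trans ?_ hq₂
    rw [lt_div_iff₀ (by linarith)]
    linarith
  have hq₂0 : 0 < q₂ := by linarith
  set α : ℝ := 1 - d / q with hα
  have hsα : s < α := by
    rw [hα, lt_sub_comm, div_lt_iff₀ hq0]
    linarith
  set β : ℝ := 1 - 1 / q₂ with hβ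
  have hsβ : s₂ < β := by
    rw [hβ, lt_sub_comm, div_lt_iff₀ hq₂0]
    linarith
  have hα0 : 0 < α := hs0.trans hsα
  have hβ0 : 0 < β := hs₂0.trans hsβ
  have hsδ : 0 < s * δ := mul_pos hs0 hδ.1
  set m := min (s * δ) s₂ with hm
  have hm0 : 0 < m := lt_min hsδ hs₂0
  have hfin : (Module.finrank ℝ (EuclideanSpace ℝ (Fin d)) : ℝ) = d := by simp
  obtain ⟨C, hC, hmorrey⟩ := exists_abs_sub_le_morrey
    (volume : Measure (EuclideanSpace ℝ (Fin d))) hq1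
    (by rw [hfin]; nlinarith) hK
  rw [hfin, ← hα] at hmorrey
  obtain ⟨R, hR0, hKR⟩ := hK.isBounded.subset_ball_lt 0 0
  have : Nonempty (Fin d) := ⟨⟨0, hd⟩⟩
  obtain ⟨c, hc⟩ := exists_norm_eq (EuclideanSpace ℝ (Fin d)) hR0.le
  have hcK : c ∉ K := fun h => by
    have := hKR h
    simp [hc] at this
  have hnormK : ∀ b ∈ K, ‖b‖ ≤ R := fun b hb => by
    have := hKR hb
    rw [mem_ball_zero_iff] at this
    exact this.le
  set D := 2 * R with hD
  have hD0 : 0 < D := by positivity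
  set A := C * D ^ (α - s) * T ^ β * T ^ (s * δ - m) with hA
  set B := C * D ^ α * T ^ (β - m) with hB
  have hA0 : 0 < A := by positivity
  have hB0 : 0 < B := by positivity
  refine ⟨A + B, by positivity, fun σ x L hσ hσ0 hxK hL hx r hr y hy => ?_⟩
  have hσd : Differentiable ℝ (Function.uncurry σ) := hσ.differentiable two_ne_zero
  have hf1 : ContDiff ℝ 1 (fderiv ℝ (Function.uncurry σ)) := hσ.fderiv_right (by norm_num)
  set W : ℝ → EuclideanSpace ℝ (Fin d) → ℝ :=
    fun t z => fderiv ℝ (Function.uncurry σ) (t, z) (1, 0) with hW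
  have hWc : ContDiff ℝ 1 (Function.uncurry W) := hf1.clm_apply contDiff_const
  have hWt : ∀ t, ContDiff ℝ 1 (W t) := fun t =>
    hWc.comp (contDiff_const.prodMk contDiff_id)
  have hder : ∀ z t, HasDerivAt (fun τ => σ τ z) (W t z) t := fun z t =>
    hasDerivAt_fst_of_differentiable hσd t z
  have hW0 : ∀ t, ∀ z ∉ K, W t z = 0 := by
    intro t z hz
    have h0 : (fun τ => σ τ z) = fun _ => 0 := funext fun τ => hσ0 τ z fun h => hz h.2
    rw [← (hder z t).deriv, h0, deriv_const]
  have hgrad : Continuous fun p : ℝ × EuclideanSpace ℝ (Fin d) => fderiv ℝ (W p.1) p.2 := by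
    have h1 := hWc.continuous_fderiv one_ne_zero
    have h2 : ∀ p : ℝ × EuclideanSpace ℝ (Fin d), fderiv ℝ (W p.1) p.2 =
        (fderiv ℝ (Function.uncurry W) p).comp (ContinuousLinearMap.inr ℝ ℝ _) := fun p =>
      fderiv_snd_of_differentiable (hWc.differentiable one_ne_zero) p.1 p.2
    simp only [h2]
    fun_prop
  set G : ℝ → ℝ := fun t => (∫ z in K, ‖fderiv ℝ (W t) z‖ ^ q) ^ (1 / q) with hGdef
  have hG0 : ∀ t, 0 ≤ G t := fun t =>
    Real.rpow_nonneg (integral_nonneg fun z => by positivity) _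
  have hG : Continuous G := by
    refine Continuous.rpow_const ?_ fun _ => Or.inr (by positivity)
    exact continuous_parametric_integral_of_continuous
      (f := fun t z => ‖fderiv ℝ (W t) z‖ ^ q)
      (hgrad.norm.rpow_const fun _ => Or.inr hq0.le) hK
  set N := mnorm d T q₂ q K (fun t z => ‖deriv (fun τ => fderiv ℝ (σ τ) z) t‖) with hN
  have hNG : N = (∫ t in Set.Icc 0 T, G t ^ q₂) ^ (1 / q₂) := by
    simp only [hN, mnorm, deriv_fderiv_eq_fderiv_deriv hσ, abs_norm, hGdef]
    congr 2
    ext t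
    rw [← Real.rpow_mul (integral_nonneg fun z => by positivity), one_div_mul_eq_div]
  have hmn : ∀ g, 0 ≤ mnorm d T q₂ q K g := fun g =>
    Real.rpow_nonneg (integral_nonneg fun t => Real.rpow_nonneg
      (integral_nonneg fun z => by positivity) _) _
  have hN0 : 0 ≤ N := hmn _
  have hint : ∀ r ∈ Set.Icc 0 T, ∀ y ∈ Set.Icc 0 T, |∫ t in y..r, G t| ≤ |r - y| ^ β * N :=
    fun r hr y hy => hNG ▸ abs_intervalIntegral_le_rpow_mul hG hG0 hq₂1 hr hy
  have hWcont : ∀ z, Continuous fun t => W t z := fun z =>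
    hWc.continuous.comp (f := fun t => (t, z)) (by fun_prop)
  have hσzero : ∀ z, σ 0 z = 0 := by
    intro z
    have hcont : Continuous fun τ => σ τ z := hσ.continuous.comp (f := fun t => (t, z))
      (by fun_prop)
    refine tendsto_nhds_unique (f := fun τ => σ τ z) (l := nhdsWithin 0 (Set.Iio 0))
      (hcont.tendsto 0 |>.mono_left nhdsWithin_le_nhds) ?_
    refine tendsto_const_nhds.congr' ?_
    filter_upwards [self_mem_nhdsWithin] with τ hτ
    exact (hσ0 τ z fun h => absurd h.1.1 (not_le.2 hτ)).symm
  have htime : ∀ b ∈ K, |σ r b - σ y b| ≤ C * D ^ α * (|r - y| ^ β * N) := by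
    intro b hb
    refine (abs_sub_le_mul_abs_integral (k := C * D ^ α) (hder b) (hWcont b) hG (by positivity)
      (fun t => ?_) y r).trans (by gcongr; exact hint r hr y hy)
    have h := hmorrey (W t) (hWt t) (hW0 t) b c
    rw [hW0 t c hcK, sub_zero] at h
    refine h.trans ?_
    have hbc : ‖b - c‖ ≤ D := by linarith [norm_sub_le b c, hnormK b hb]
    have := hG0 t
    simp only [hGdef] at this ⊢
    gcongr
  have hspace : ∀ a b, |σ r a - σ r b| ≤ C * ‖a - b‖ ^ α * (T ^ β * N) := by
    intro a b
    have h := abs_sub_le_mul_abs_integral (v := fun t => σ t a - σ t b)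
      (v' := fun t => W t a - W t b) (G := G) (k := C * ‖a - b‖ ^ α)
      (fun t => (hder a t).sub (hder b t)) ((hWcont a).sub (hWcont b)) hG (by positivity)
      (fun t => hmorrey (W t) (hWt t) (hW0 t) a b) 0 r
    simp only [hσzero, sub_zero] at h
    have h2 := hint r hr 0 ⟨le_rfl, hT.le⟩
    rw [sub_zero, abs_of_nonneg hr.1] at h2
    refine h.trans ?_
    gcongr
    refine h2.trans ?_
    have := hr.1
    have := hr.2
    gcongr
  have hry : |r - y| ≤ T := by
    rw [abs_le]
    exact ⟨by linarith [hr.1, hy.2], by linarith [hr.2, hy.1]⟩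
  set ρ := |r - y|
  have hρ0 : 0 ≤ ρ := abs_nonneg _
  have h1 : |σ r (x r) - σ r (x y)| ≤ A * L ^ s * N * ρ ^ m := by
    have hxD : ‖x r - x y‖ ≤ D := by
      linarith [norm_sub_le (x r) (x y), hnormK _ (hxK r hr), hnormK _ (hxK y hy)]
    have hxs : ‖x r - x y‖ ^ s ≤ L ^ s * (T ^ (s * δ - m) * ρ ^ m) := by
      calc ‖x r - x y‖ ^ s ≤ (L * ρ ^ δ) ^ s := by
            gcongr
            rw [← dist_eq_norm]
            exact hx r hr y hy
        _ = L ^ s * ρ ^ (s * δ) := by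
            rw [Real.mul_rpow hL (by positivity), ← Real.rpow_mul hρ0, mul_comm δ]
        _ ≤ _ := by
            gcongr
            exact Real.rpow_le_rpow_sub_mul_rpow hρ0 hry hm0 (min_le_left _ _)
    calc _ ≤ C * ‖x r - x y‖ ^ α * (T ^ β * N) := hspace _ _
      _ ≤ C * (D ^ (α - s) * (L ^ s * (T ^ (s * δ - m) * ρ ^ m))) * (T ^ β * N) := by
          gcongr
          refine (Real.rpow_le_rpow_sub_mul_rpow (norm_nonneg _) hxD hs0 hsα.le).trans ?_
          gcongr
      _ = _ := by rw [hA]; ring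
  have h2 : |σ r (x y) - σ y (x y)| ≤ B * N * ρ ^ m := by
    calc _ ≤ C * D ^ α * (ρ ^ β * N) := htime _ (hxK y hy)
      _ ≤ C * D ^ α * (T ^ (β - m) * ρ ^ m * N) := by
          gcongr
          exact Real.rpow_le_rpow_sub_mul_rpow hρ0 hry hm0 ((min_le_right _ _).trans hsβ.le)
      _ = _ := by rw [hB]; ring
  have hLs : 0 ≤ L ^ s := Real.rpow_nonneg hL s
  calc |σ r (x r) - σ y (x y)|
      ≤ |σ r (x r) - σ r (x y)| + |σ r (x y) - σ y (x y)| := abs_sub_le _ _ _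
    _ ≤ A * L ^ s * N * ρ ^ m + B * N * ρ ^ m := add_le_add h1 h2
    _ = (A * L ^ s + B) * N * ρ ^ m := by ring
    _ ≤ (A + B) * (1 + L ^ s) * N * ρ ^ m := by
        gcongr
        nlinarith [mul_nonneg hB0.le hLs]
    _ ≤ _ := by
        gcongr
        rw [add_assoc]
        exact le_add_of_nonneg_right (add_nonneg (hmn _) (hmn _))
end

section
/- For H ∈ (1/2,1) set C_H := (-2 Γ(-2H) Γ(1/2+H)/Γ(1/2-H))^{-1/2}, and for H₁, H₂ ∈ (1/2,1) set f(H₁,H₂) := -Γ(-H₁-H₂) C_{H₁} C_{H₂} ( Γ(1/2+H₁)/Γ(1/2-H₂) + Γ(1/2+H₂)/Γ(1/2-H₁) ). Let 1/2 < H̲ < H̄ < 1, ε > 0 and T₀ > 0. Then there exists a constant C = C(H̲, H̄, ε, T₀) such that for all H₂, H₁ with H̲ ≤ H₂ ≤ H₁ ≤ H̄ and all v ∈ (0, T₀], v^{2H₁} + v^{2H₂} - 2 v^{H₁+H₂} f(H₁,H₂) ≤ C v^{2H₂ - ε} (H₁ - H₂). -/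
/-- The fBm normalization constant `C_H = (-2Γ(-2H)Γ(1/2+H)/Γ(1/2-H))^{-1/2}`. -/
noncomputable def CH (H : ℝ) : ℝ :=
  (-2 * Real.Gamma (-2 * H) * Real.Gamma (1/2 + H) / Real.Gamma (1/2 - H)) ^ (-(1/2) : ℝ)

/-- The normalized cross-covariance factor
`f(H₁,H₂) = -Γ(-H₁-H₂) C_{H₁} C_{H₂} (Γ(1/2+H₁)/Γ(1/2-H₂) + Γ(1/2+H₂)/Γ(1/2-H₁))`. -/
noncomputable def fcov (H₁ H₂ : ℝ) : ℝ :=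
  -Real.Gamma (-H₁ - H₂) * CH H₁ * CH H₂ *
    (Real.Gamma (1/2 + H₁) / Real.Gamma (1/2 - H₂) +
     Real.Gamma (1/2 + H₂) / Real.Gamma (1/2 - H₁))

/-- The real Gamma function is smooth away from the non-positive integers. -/
theorem Real.contDiffAt_Gamma {n : WithTop ℕ∞} {s : ℝ} (hs : ∀ m : ℕ, s ≠ -m) :
    ContDiffAt ℝ n Real.Gamma s := by
  have hinv : ContDiffAt ℝ n (fun x : ℝ => (Complex.Gamma x)⁻¹.re) s :=
    (Complex.differentiable_one_div_Gamma.contDiff (n := n)).contDiffAt.real_of_complex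
  have heq : (fun x : ℝ => (Complex.Gamma x)⁻¹.re) = fun x => (Real.Gamma x)⁻¹ := by
    funext x
    rw [Complex.Gamma_ofReal, ← Complex.ofReal_inv, Complex.ofReal_re]
  rw [heq] at hinv
  simpa only [Pi.inv_def, inv_inv] using hinv.inv (inv_ne_zero (Real.Gamma_ne_zero hs))

theorem Real.Gamma_neg_of_mem_Ioo {s : ℝ} (hs : s ∈ Set.Ioo (-1) 0) : Real.Gamma s < 0 := by
  have h := Real.Gamma_add_one hs.2.ne
  have hpos := Real.Gamma_pos_of_pos (s := s + 1) (by linarith [hs.1])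
  nlinarith [hs.2]

theorem Real.Gamma_pos_of_mem_Ioo {s : ℝ} (hs : s ∈ Set.Ioo (-2) (-1)) : 0 < Real.Gamma s := by
  have h := Real.Gamma_add_one (s := s) (by linarith [hs.2])
  have hneg := Real.Gamma_neg_of_mem_Ioo (s := s + 1) ⟨by linarith [hs.1], by linarith [hs.2]⟩
  nlinarith [hs.2]

theorem ne_neg_natCast_of_mem_Ioo {s : ℝ} {k : ℤ} (hs : s ∈ Set.Ioo (k : ℝ) (k + 1)) (m : ℕ) :
    s ≠ -m := by
  rintro rfl
  have h₁ : k < -(m : ℤ) := by exact_mod_cast hs.1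
  have h₂ : -(m : ℤ) < k + 1 := by exact_mod_cast hs.2
  omega

/-- The quantity under the root in the normalization constant is positive. -/
theorem CH_base_pos {H : ℝ} (hH : H ∈ Set.Ioo (1 / 2) 1) :
    0 < -2 * Real.Gamma (-2 * H) * Real.Gamma (1/2 + H) / Real.Gamma (1/2 - H) := by
  obtain ⟨hl, hu⟩ := hH
  have h₁ := Real.Gamma_pos_of_mem_Ioo (s := -2 * H) ⟨by linarith, by linarith⟩
  have h₂ := Real.Gamma_pos_of_pos (s := 1/2 + H) (by linarith)
  have h₃ := Real.Gamma_neg_of_mem_Ioo (s := 1/2 - H) ⟨by linarith, by linarith⟩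
  exact div_pos_of_neg_of_neg (by nlinarith [mul_pos h₁ h₂]) h₃

theorem fcov_self {H : ℝ} (hH : H ∈ Set.Ioo (1 / 2) 1) : fcov H H = 1 := by
  have hpos := CH_base_pos hH
  have hsq : CH H * CH H =
      (-2 * Real.Gamma (-2 * H) * Real.Gamma (1/2 + H) / Real.Gamma (1/2 - H))⁻¹ := by
    rw [CH, ← Real.rpow_add hpos, ← Real.rpow_neg_one]
    norm_num
  calc fcov H H = (CH H * CH H) *
        (-2 * Real.Gamma (-2 * H) * Real.Gamma (1/2 + H) / Real.Gamma (1/2 - H)) := by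
        rw [fcov, show -H - H = -2 * H by ring]; ring
    _ = 1 := by rw [hsq, inv_mul_cancel₀ hpos.ne']

theorem contDiffAt_Gamma_half_sub {n : WithTop ℕ∞} {H : ℝ} (hH : H ∈ Set.Ioo (1 / 2) 1) :
    ContDiffAt ℝ n (fun x => Real.Gamma (1/2 - x)) H :=
  (Real.contDiffAt_Gamma (ne_neg_natCast_of_mem_Ioo (k := -1)
    ⟨by push_cast; linarith [hH.2], by push_cast; linarith [hH.1]⟩)).comp H (by fun_prop)

theorem contDiffAt_Gamma_half_add {n : WithTop ℕ∞} {H : ℝ} (hH : H ∈ Set.Ioo (1 / 2) 1) :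
    ContDiffAt ℝ n (fun x => Real.Gamma (1/2 + x)) H :=
  (Real.contDiffAt_Gamma (ne_neg_natCast_of_mem_Ioo (k := 1)
    ⟨by push_cast; linarith [hH.1], by push_cast; linarith [hH.2]⟩)).comp H (by fun_prop)

theorem Gamma_half_sub_ne_zero {H : ℝ} (hH : H ∈ Set.Ioo (1 / 2) 1) :
    Real.Gamma (1/2 - H) ≠ 0 :=
  (Real.Gamma_neg_of_mem_Ioo ⟨by linarith [hH.2], by linarith [hH.1]⟩).ne

theorem contDiffAt_CH {n : WithTop ℕ∞} {H : ℝ} (hH : H ∈ Set.Ioo (1 / 2) 1) :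
    ContDiffAt ℝ n CH H := by
  have h : ContDiffAt ℝ n (fun x => Real.Gamma (-2 * x)) H :=
    (Real.contDiffAt_Gamma (ne_neg_natCast_of_mem_Ioo (k := -2)
      ⟨by push_cast; linarith [hH.2], by push_cast; linarith [hH.1]⟩)).comp H (by fun_prop)
  exact (((contDiffAt_const.mul h).mul (contDiffAt_Gamma_half_add hH)).div
    (contDiffAt_Gamma_half_sub hH) (Gamma_half_sub_ne_zero hH)).rpow_const_of_ne
    (CH_base_pos hH).ne'

theorem contDiffAt_fcov {n : WithTop ℕ∞} {p : ℝ × ℝ} (h₁ : p.1 ∈ Set.Ioo (1 / 2) 1)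
    (h₂ : p.2 ∈ Set.Ioo (1 / 2) 1) : ContDiffAt ℝ n (fun q : ℝ × ℝ => fcov q.1 q.2) p := by
  have h : ContDiffAt ℝ n (fun q : ℝ × ℝ => Real.Gamma (-q.1 - q.2)) p :=
    (Real.contDiffAt_Gamma (ne_neg_natCast_of_mem_Ioo (k := -2)
      ⟨by push_cast; linarith [h₁.2, h₂.2], by push_cast; linarith [h₁.1, h₂.1]⟩)).comp p
      (by fun_prop)
  have hC₁ := (contDiffAt_CH (n := n) h₁).comp p contDiffAt_fst
  have hC₂ := (contDiffAt_CH (n := n) h₂).comp p contDiffAt_snd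
  have ha₁ := (contDiffAt_Gamma_half_add (n := n) h₁).comp p contDiffAt_fst
  have ha₂ := (contDiffAt_Gamma_half_add (n := n) h₂).comp p contDiffAt_snd
  have hs₁ := (contDiffAt_Gamma_half_sub (n := n) h₁).comp p contDiffAt_fst
  have hs₂ := (contDiffAt_Gamma_half_sub (n := n) h₂).comp p contDiffAt_snd
  exact ((h.neg.mul hC₁).mul hC₂).mul ((ha₁.div hs₂ (Gamma_half_sub_ne_zero h₂)).add
    (ha₂.div hs₁ (Gamma_half_sub_ne_zero h₁)))

/-- Lipschitz bound for `fcov` off the diagonal, where it equals `1`. -/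
theorem exists_one_sub_fcov_le {a b : ℝ} (ha : 1 / 2 < a) (hb : b < 1) :
    ∃ K ≥ 0, ∀ H₂ H₁ : ℝ, a ≤ H₂ → H₂ ≤ H₁ → H₁ ≤ b → 1 - fcov H₁ H₂ ≤ K * (H₁ - H₂) := by
  have hsub : ∀ x ∈ Set.Icc a b, x ∈ Set.Ioo (1 / 2 : ℝ) 1 := fun x hx =>
    ⟨ha.trans_le hx.1, hx.2.trans_lt hb⟩
  have hcd : ContDiffOn ℝ 1 (fun q : ℝ × ℝ => fcov q.1 q.2) (Set.Icc a b ×ˢ Set.Icc a b) :=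
    fun p hp => (contDiffAt_fcov (hsub _ hp.1) (hsub _ hp.2)).contDiffWithinAt
  obtain ⟨K, hK⟩ := hcd.exists_lipschitzOnWith one_ne_zero
    ((convex_Icc a b).prod (convex_Icc a b)) (isCompact_Icc.prod isCompact_Icc)
  refine ⟨K, K.2, fun H₂ H₁ hl h hu => ?_⟩
  have h₁ : H₁ ∈ Set.Icc a b := ⟨hl.trans h, hu⟩
  have h₂ : H₂ ∈ Set.Icc a b := ⟨hl, h.trans hu⟩
  have hd := hK.dist_le_mul (H₂, H₂) ⟨h₂, h₂⟩ (H₁, H₂) ⟨h₁, h₂⟩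
  rw [dist_prod_same_right, dist_comm H₂ H₁, Real.dist_eq, Real.dist_eq,
    abs_of_nonneg (sub_nonneg.2 h), fcov_self (hsub _ h₂)] at hd
  exact (le_abs_self _).trans hd

/-- Quantitative smallness in `δ` of `(v ^ δ - 1) ^ 2`, at the cost of a factor `v ^ ε`. -/
theorem rpow_mul_rpow_sub_one_sq_le {v δ ε M : ℝ} (hv : 0 < v) (hM : 1 ≤ M) (hvM : v ≤ M)
    (hδ₀ : 0 ≤ δ) (hδ₁ : δ ≤ 1) (hε : 0 < ε) :
    v ^ ε * (v ^ δ - 1) ^ 2 ≤ (1 / ε + M ^ 3 * M ^ ε) * δ := by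
  have hMpos : 0 < M := by linarith
  have hvε := Real.rpow_pos_of_pos hv ε
  have hvδ := Real.rpow_pos_of_pos hv δ
  have hMε := Real.rpow_pos_of_pos hMpos ε
  have hexp : ∀ x : ℝ, 1 + Real.log v * x ≤ v ^ x := fun x => by
    rw [Real.rpow_def_of_pos hv]
    linarith [Real.add_one_le_exp (Real.log v * x)]
  rcases le_total v 1 with hv1 | hv1
  · have hle : v ^ δ ≤ 1 := Real.rpow_le_one hv.le hv1 hδ₀
    have hlog := (Real.abs_log_mul_self_rpow_lt v ε hv hv1 hε).le
    have hsq : (v ^ δ - 1) ^ 2 ≤ -Real.log v * δ := by nlinarith [hexp δ]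
    calc v ^ ε * (v ^ δ - 1) ^ 2 ≤ v ^ ε * (-Real.log v * δ) := by gcongr
      _ = -(Real.log v * v ^ ε) * δ := by ring
      _ ≤ (1 / ε) * δ := by gcongr; exact (neg_le_abs _).trans hlog
      _ ≤ (1 / ε + M ^ 3 * M ^ ε) * δ := by
        gcongr; exact le_add_of_nonneg_right (by positivity)
  · have hge : 1 ≤ v ^ δ := Real.one_le_rpow hv1 hδ₀
    have hup : v ^ δ ≤ M :=
      (Real.rpow_le_rpow_of_exponent_le hv1 hδ₁).trans (by rwa [Real.rpow_one])
    have hlog₀ : 0 ≤ Real.log v := Real.log_nonneg hv1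
    have hlog : Real.log v ≤ M := by linarith [Real.log_le_sub_one_of_pos hv]
    have hinv : v ^ δ * v ^ (-δ) = 1 := by rw [← Real.rpow_add hv]; simp
    have hlin : v ^ δ - 1 ≤ M * (M * δ) := by
      calc v ^ δ - 1 ≤ v ^ δ * (Real.log v * δ) := by nlinarith [hexp (-δ)]
        _ ≤ M * (M * δ) := by gcongr
    calc v ^ ε * (v ^ δ - 1) ^ 2 = v ^ ε * ((v ^ δ - 1) * (v ^ δ - 1)) := by ring
      _ ≤ M ^ ε * (M * (M * (M * δ))) := by
        gcongr
        linarith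
      _ = M ^ 3 * M ^ ε * δ := by ring
      _ ≤ (1 / ε + M ^ 3 * M ^ ε) * δ := by
        gcongr; exact le_add_of_nonneg_left (by positivity)

/-- Variance bound for the increment of the difference of two fBms built from the same
Wiener process: `v^{2H₁} + v^{2H₂} - 2 v^{H₁+H₂} f(H₁,H₂) ≤ C v^{2H₂-ε} (H₁-H₂)` for
`H̲ ≤ H₂ ≤ H₁ ≤ H̄` and `v ∈ (0,T₀]`. -/
theorem stmt16 (Hlow Hhigh ε T₀ : ℝ) (h₁ : 1/2 < Hlow) (h₂ : Hhigh < 1) (h₃ : Hlow ≤ Hhigh)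
    (hε : 0 < ε) (hT₀ : 0 < T₀) :
    ∃ C > 0, ∀ H₂ H₁ v : ℝ, Hlow ≤ H₂ → H₂ ≤ H₁ → H₁ ≤ Hhigh → 0 < v → v ≤ T₀ →
      v ^ (2 * H₁) + v ^ (2 * H₂) - 2 * v ^ (H₁ + H₂) * fcov H₁ H₂ ≤
        C * v ^ (2 * H₂ - ε) * (H₁ - H₂) := by
  obtain ⟨K, hK₀, hK⟩ := exists_one_sub_fcov_le h₁ h₂
  set M := max 1 T₀
  have hM : 1 ≤ M := le_max_left _ _
  have hMpos : 0 < M := by linarith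
  have hMε := Real.rpow_pos_of_pos hMpos ε
  refine ⟨1 / ε + M ^ 3 * M ^ ε + 2 * (M * M ^ ε) * K, by positivity, ?_⟩
  intro H₂ H₁ v hl h hu hv hvT
  have hvM : v ≤ M := hvT.trans (le_max_right _ _)
  have hδ₀ : 0 ≤ H₁ - H₂ := sub_nonneg.2 h
  have hδ₁ : H₁ - H₂ ≤ 1 := by linarith
  have hmain := rpow_mul_rpow_sub_one_sq_le hv hM hvM hδ₀ hδ₁ hε
  have hrem : v ^ (H₁ - H₂) * v ^ ε * (1 - fcov H₁ H₂) ≤ M * M ^ ε * (K * (H₁ - H₂)) := by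
    have hδ : v ^ (H₁ - H₂) ≤ M :=
      (Real.rpow_le_rpow hv.le hvM hδ₀).trans <|
        (Real.rpow_le_rpow_of_exponent_le hM hδ₁).trans (by rw [Real.rpow_one])
    calc v ^ (H₁ - H₂) * v ^ ε * (1 - fcov H₁ H₂)
        ≤ v ^ (H₁ - H₂) * v ^ ε * (K * (H₁ - H₂)) := by gcongr; exact hK H₂ H₁ hl h hu
      _ ≤ M * M ^ ε * (K * (H₁ - H₂)) := by gcongr
  have e₁ : v ^ (2 * H₁) = v ^ (2 * H₂ - ε) * (v ^ ε * (v ^ (H₁ - H₂) * v ^ (H₁ - H₂))) := by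
    simp only [← Real.rpow_add hv]; ring_nf
  have e₂ : v ^ (2 * H₂) = v ^ (2 * H₂ - ε) * v ^ ε := by
    simp only [← Real.rpow_add hv]; ring_nf
  have e₃ : v ^ (H₁ + H₂) = v ^ (2 * H₂ - ε) * (v ^ ε * v ^ (H₁ - H₂)) := by
    simp only [← Real.rpow_add hv]; ring_nf
  calc v ^ (2 * H₁) + v ^ (2 * H₂) - 2 * v ^ (H₁ + H₂) * fcov H₁ H₂
      = v ^ (2 * H₂ - ε) * (v ^ ε * (v ^ (H₁ - H₂) - 1) ^ 2 +
          2 * (v ^ (H₁ - H₂) * v ^ ε * (1 - fcov H₁ H₂))) := by rw [e₁, e₂, e₃]; ring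
    _ ≤ v ^ (2 * H₂ - ε) * ((1 / ε + M ^ 3 * M ^ ε) * (H₁ - H₂) +
          2 * (M * M ^ ε * (K * (H₁ - H₂)))) := by gcongr
    _ = (1 / ε + M ^ 3 * M ^ ε + 2 * (M * M ^ ε) * K) * v ^ (2 * H₂ - ε) * (H₁ - H₂) := by ring
end
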